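/- arXiv:1205.4994 — 4 statements merged into one kernel-verified Lean document; each statement's English description precedes it below -/
import Mathlib

section
/- Let t > 2, let (X,B) be a t-(v,k,m,λ) general covering design, and let S be a set of n new points with X ∩ S = ∅ and n ≤ k−t+1. Fix a point a ∈ X and let B(a) = {B∖{a} : B ∈ B, a ∈ B}. Let (X∖{a}, C) be a (t−2)-(v−1, k−n−1, m−2, λ) general covering design. Define B₁ = B, B₂ = {B ∪ {s} : B ∈ B(a), s ∈ S}, and B₃ = {C ∪ S ∪ {a} : C ∈ C}. Then (X ∪ S, B₁ ∪ B₂ ∪ B₃) is a t-(v+n, k, m, λ) general covering design. -/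
/-- `(X, Bs)` is a `t`-`(|X|, k, m, lam)` general covering design: `Bs` is a multiset of
`k`-subsets of `X` such that every `m`-subset of `X` intersects at least `lam` blocks of `Bs`
(counted with multiplicity) in at least `t` points. -/
def IsGenCover {α : Type*} [DecidableEq α] (X : Finset α) (Bs : Multiset (Finset α))
    (k t m lam : ℕ) : Prop :=
  (∀ B ∈ Bs, B ⊆ X ∧ B.card = k) ∧
  ∀ M ⊆ X, M.card = m → lam ≤ (Bs.filter (fun B => t ≤ (M ∩ B).card)).card

theorem Multiset.le_card_filter_of_le {β : Type*} {p : β → Prop} [DecidablePred p]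
    {D E : Multiset β} {l : ℕ} (hDE : D ≤ E) (hp : ∀ x ∈ D, p x) (hl : l ≤ D.card) :
    l ≤ (E.filter p).card :=
  hl.trans (Multiset.card_le_card (Multiset.le_filter.2 ⟨hDE, hp⟩))

/-- If `M` meets `T` in at least two points, then adjoining `T` to the blocks of a
`(t - 2)`-cover on a set `Y` disjoint from `T` covers `M` in `t` points. -/
theorem IsGenCover.le_card_filter_map_union {α : Type*} [DecidableEq α] {Y T M : Finset α}
    {𝓒 : Multiset (Finset α)} {k t m lam : ℕ} (h𝓒 : IsGenCover Y 𝓒 k (t - 2) (m - 2) lam)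
    (hYT : Disjoint Y T) (hM : M ⊆ Y ∪ T) (hMm : M.card = m) (hmY : m - 2 ≤ Y.card)
    (hMT : 2 ≤ (M ∩ T).card) :
    lam ≤ ((𝓒.map (fun C => C ∪ T)).filter (fun B => t ≤ (M ∩ B).card)).card := by
  have hsplit : (M ∩ Y).card + (M ∩ T).card = m := by
    rw [← Finset.card_union_of_disjoint
      (hYT.mono Finset.inter_subset_right Finset.inter_subset_right),
      ← Finset.inter_union_distrib_left, Finset.inter_eq_left.2 hM, hMm]
  obtain ⟨N, hMN, hNY, hN⟩ := Finset.exists_subsuperset_card_eq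
    (Finset.inter_subset_right : M ∩ Y ⊆ Y) (by omega : (M ∩ Y).card ≤ m - 2) hmY
  refine Multiset.le_card_filter_of_le
    (Multiset.map_le_map (Multiset.filter_le (fun C => t - 2 ≤ (N ∩ C).card) 𝓒)) ?_
    (by simpa only [Multiset.card_map] using h𝓒.2 N hNY hN)
  intro D hD
  obtain ⟨C, hC, rfl⟩ := Multiset.mem_map.1 hD
  obtain ⟨hC, hNC⟩ := Multiset.mem_filter.1 hC
  have hCY := (h𝓒.1 C hC).1
  have hdisj : Disjoint (M ∩ C) (M ∩ T) :=
    (hYT.mono_left hCY).mono Finset.inter_subset_right Finset.inter_subset_right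
  have hsub : N ∩ C ⊆ (M ∩ C) ∪ (N \ (M ∩ Y)) := by
    intro x hx
    have := @hCY x
    grind
  have h1 := (Finset.card_le_card hsub).trans (Finset.card_union_le _ _)
  rw [Finset.card_sdiff_of_subset hMN] at h1
  rw [Finset.inter_union_distrib_left, Finset.card_union_of_disjoint hdisj]
  omega

/-- If `M` contains `s` but not `a`, then replacing `a` by `s` in the blocks through `a` of a
cover containing `M` with `s` replaced by `a` covers `M`. -/
theorem IsGenCover.le_card_filter_union_map_insert {α : Type*} [DecidableEq α] {X M : Finset α}
    {𝓑 : Multiset (Finset α)} {k t m lam : ℕ} (h𝓑 : IsGenCover X 𝓑 k t m lam) {a s : α}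
    (ha : a ∈ X) (hs : s ∉ X) (haM : a ∉ M) (hsM : s ∈ M) (hM : M ⊆ insert s X)
    (hMm : M.card = m) :
    lam ≤ ((𝓑 ∪ ((𝓑.filter (fun B => a ∈ B)).map (fun B => B.erase a)).map
      (fun B => insert s B)).filter (fun B => t ≤ (M ∩ B).card)).card := by
  have hN : (insert a (M.erase s)).card = m := by
    rw [Finset.card_insert_of_notMem (by simp [haM]), Finset.card_erase_add_one hsM, hMm]
  have hNX : insert a (M.erase s) ⊆ X := by grind
  have hcov := h𝓑.2 _ hNX hN
  set G := 𝓑.filter (fun B => t ≤ (insert a (M.erase s) ∩ B).card) with hG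
  set F := ((G.filter (fun B => a ∈ B)).map (fun B => B.erase a)).map (fun B => insert s B)
    with hF
  have hGB : G ≤ 𝓑 := Multiset.filter_le _ _
  have hdisj : Disjoint (G.filter (fun B => a ∉ B)) F := by
    rw [Multiset.disjoint_left]
    intro B hB hBF
    simp only [hF, Multiset.mem_map] at hBF
    obtain ⟨D, -, rfl⟩ := hBF
    exact hs ((h𝓑.1 _ (Multiset.mem_of_le hGB (Multiset.mem_of_mem_filter hB))).1
      (Finset.mem_insert_self s D))
  refine Multiset.le_card_filter_of_le (D := G.filter (fun B => a ∉ B) ∪ F) ?_ ?_ ?_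
  · exact Multiset.union_le
      (((Multiset.filter_le _ _).trans hGB).trans Multiset.le_union_left)
      ((Multiset.map_le_map (Multiset.map_le_map (Multiset.filter_le_filter _ hGB))).trans
        Multiset.le_union_right)
  · intro D hD
    rcases Multiset.mem_union.1 hD with hD | hD
    · obtain ⟨hD, haD⟩ := Multiset.mem_filter.1 hD
      refine (Multiset.mem_filter.1 hD).2.trans (Finset.card_le_card ?_)
      grind
    · simp only [hF, Multiset.map_map, Multiset.mem_map, Multiset.mem_filter,
        Function.comp_apply] at hD
      obtain ⟨B, ⟨hB, haB⟩, rfl⟩ := hD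
      obtain ⟨hB, htB⟩ := Multiset.mem_filter.1 hB
      have hsB : s ∉ B := fun h => hs ((h𝓑.1 B hB).1 h)
      have h1 : insert a (M.erase s) ∩ B = insert a (M ∩ B) := by grind
      have h2 : M ∩ insert s (B.erase a) = insert s (M ∩ B) := by grind
      rw [h1, Finset.card_insert_of_notMem (by simp [haM])] at htB
      rwa [h2, Finset.card_insert_of_notMem (by simp [hsB])]
  · rw [← Multiset.add_eq_union_iff_disjoint.2 hdisj, Multiset.card_add, hF, Multiset.card_map,
      Multiset.card_map, add_comm, ← Multiset.card_add, Multiset.filter_add_not]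
    exact hcov

/-- Point splicing construction for `t`-`(v,k,m,λ)` general covers: from a
`t`-`(v,k,m,λ)` general cover `(X, 𝓑)`, a set `S` of `n` new points, a point `a ∈ X`
and a `(t-2)`-`(v-1, k-n-1, m-2, λ)` general cover `(X \ {a}, 𝓒)`, we obtain a
`t`-`(v+n,k,m,λ)` general cover on `X ∪ S` whose blocks are
`𝓑₁ = 𝓑`, `𝓑₂ = {B ∪ {s} : B ∈ 𝓑(a), s ∈ S}`, `𝓑₃ = {C ∪ S ∪ {a} : C ∈ 𝓒}`
(multiset union taken with maximum multiplicities). -/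
theorem point_splicing_general {α : Type*} [DecidableEq α]
    (v k t m lam n : ℕ)
    (ht : 2 < t) (hkt : t ≤ k) (hvk : k ≤ v) (hmt : t ≤ m) (hvm : m ≤ v)
    (hlam : 0 < lam) (hn : 0 < n) (hnk : n ≤ k - t + 1)
    (X S : Finset α) (hX : X.card = v) (hS : S.card = n) (hXS : Disjoint X S)
    (𝓑 : Multiset (Finset α)) (h𝓑 : IsGenCover X 𝓑 k t m lam)
    (a : α) (ha : a ∈ X)
    (𝓒 : Multiset (Finset α))
    (h𝓒 : IsGenCover (X.erase a) 𝓒 (k - n - 1) (t - 2) (m - 2) lam) :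
    IsGenCover (X ∪ S)
      (𝓑 ∪
        ((𝓑.filter (fun B => a ∈ B)).map (fun B => B.erase a)).bind
          (fun B => S.val.map (fun s => insert s B)) ∪
        𝓒.map (fun C => C ∪ S ∪ {a}))
      k t m lam := by
  have haS : a ∉ S := fun h => Finset.disjoint_left.1 hXS ha h
  have hYT : Disjoint (X.erase a) (S ∪ {a}) := by
    rw [Finset.disjoint_left] at hXS ⊢
    grind
  have hT : (S ∪ {a}).card = n + 1 := by
    rw [Finset.card_union_of_disjoint (by simpa using haS), hS, Finset.card_singleton]
  simp only [Finset.union_assoc]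
  refine ⟨fun B hB => ?_, fun M hM hMm => ?_⟩
  · simp only [Multiset.mem_union, Multiset.mem_bind, Multiset.mem_map, Multiset.mem_filter,
      Finset.mem_val] at hB
    rcases hB with (hB | ⟨_, ⟨D, ⟨hD, haD⟩, rfl⟩, s, hs, rfl⟩) | ⟨C, hC, rfl⟩
    · exact ⟨(h𝓑.1 B hB).1.trans Finset.subset_union_left, (h𝓑.1 B hB).2⟩
    · obtain ⟨hDX, hDk⟩ := h𝓑.1 D hD
      have hsD : s ∉ D := fun h => Finset.disjoint_left.1 hXS (hDX h) hs
      refine ⟨by grind, ?_⟩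
      rw [Finset.card_insert_of_notMem (by simp [hsD]), Finset.card_erase_add_one haD, hDk]
    · obtain ⟨hCX, hCk⟩ := h𝓒.1 C hC
      refine ⟨by grind, ?_⟩
      rw [Finset.card_union_of_disjoint (hYT.mono_left hCX), hCk, hT]
      omega
  · by_cases h2 : 2 ≤ (M ∩ (S ∪ {a})).card
    · refine (h𝓒.le_card_filter_map_union hYT (by grind) hMm ?_ h2).trans
        (Multiset.card_le_card (Multiset.filter_le_filter _ Multiset.le_union_right))
      rw [Finset.card_erase_of_mem ha, hX]
      omega
    by_cases hMX : M ⊆ X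
    · exact (h𝓑.2 M hMX hMm).trans (Multiset.card_le_card (Multiset.filter_le_filter _
        (Multiset.le_union_left.trans Multiset.le_union_left)))
    obtain ⟨s, hsM, hsX⟩ := Finset.not_subset.1 hMX
    have hsS : s ∈ S := by grind
    have h1 : ∀ x ∈ M, x ∈ S ∪ {a} → x = s := fun x hx hxS =>
      Finset.card_le_one.1 (by omega) x (Finset.mem_inter.2 ⟨hx, hxS⟩) s (by grind)
    have haM : a ∉ M := fun h => hsX (h1 a h (by simp) ▸ ha)
    refine (h𝓑.le_card_filter_union_map_insert ha hsX haM hsM (by grind) hMm).trans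
      (Multiset.card_le_card (Multiset.filter_le_filter _
        (le_trans (Multiset.union_le_union_left ?_ _) Multiset.le_union_left)))
    rw [Multiset.bind_map_comm]
    exact Multiset.le_bind (f := fun s => Multiset.map (fun B => insert s B) _) S.val hsS
end

section
/- Let t > 2 and let v, m, k, λ, n be positive integers with v ≥ k ≥ t, v ≥ m ≥ t and 1 ≤ n ≤ k−t+1. Then C_λ(v+n, k, t, m) ≤ n·⌊k·C_λ(v,k,t,m)/v⌋ + C_λ(v,k,t,m) + C_λ(v−1, k−n−1, t−2, m−2). -/
/-- The general covering number `C_λ(v,k,t,m)`: the minimum number of blocks of a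
`t`-`(v,k,m,λ)` general covering design. -/
noncomputable def genCoverNumber (v k t m lam : ℕ) : ℕ :=
  sInf { b | ∃ Bs : Multiset (Finset (Fin v)),
    IsGenCover Finset.univ Bs k t m lam ∧ Multiset.card Bs = b }

theorem IsGenCover.map {α β : Type*} [DecidableEq α] [DecidableEq β] {X : Finset α}
    {Bs : Multiset (Finset α)} {k t m lam : ℕ} (h : IsGenCover X Bs k t m lam) (f : α ↪ β) :
    IsGenCover (X.map f) (Bs.map (Finset.map f)) k t m lam := by
  refine ⟨fun B hB => ?_, fun M hM hcard => ?_⟩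
  · obtain ⟨A, hA, rfl⟩ := Multiset.mem_map.1 hB
    exact ⟨Finset.map_subset_map.2 (h.1 A hA).1, by rw [Finset.card_map, (h.1 A hA).2]⟩
  · obtain ⟨M, hMX, rfl⟩ := Finset.subset_map_iff.1 hM
    rw [Finset.card_map] at hcard
    simpa [Multiset.filter_map, Function.comp_def, ← Finset.map_inter] using h.2 M hMX hcard

theorem exists_isGenCover {α : Type*} [DecidableEq α] (X : Finset α) {k t m : ℕ} (lam : ℕ)
    (htk : t ≤ k) (hkX : k ≤ X.card) (htm : t ≤ m) :
    ∃ Bs : Multiset (Finset α), IsGenCover X Bs k t m lam := by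
  refine ⟨lam • (X.powersetCard k).val, fun B hB => ?_, fun M hM hcard => ?_⟩
  · exact Finset.mem_powersetCard.1 (Multiset.mem_of_mem_nsmul hB)
  · obtain ⟨T, hTM, hT⟩ := Finset.exists_subset_card_eq (htm.trans hcard.ge)
    obtain ⟨B, hTB, hBX, hB⟩ :=
      Finset.exists_subsuperset_card_eq (hTM.trans hM) (hT.le.trans htk) hkX
    have hmem : B ∈ (X.powersetCard k).val.filter (fun B => t ≤ (M ∩ B).card) :=
      Multiset.mem_filter.2 ⟨Finset.mem_powersetCard.2 ⟨hBX, hB⟩,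
        hT.ge.trans (Finset.card_le_card (Finset.subset_inter hTM hTB))⟩
    rw [Multiset.filter_nsmul, Multiset.card_nsmul]
    exact Nat.le_mul_of_pos_right _ (Multiset.card_pos_iff_exists_mem.2 ⟨B, hmem⟩)

theorem genCoverNumber_le {v k t m lam : ℕ} {Bs : Multiset (Finset (Fin v))}
    (h : IsGenCover Finset.univ Bs k t m lam) :
    genCoverNumber v k t m lam ≤ Multiset.card Bs :=
  Nat.sInf_le ⟨Bs, h, rfl⟩

theorem exists_isGenCover_card_eq {v k t m : ℕ} (lam : ℕ) (htk : t ≤ k) (hkv : k ≤ v)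
    (htm : t ≤ m) : ∃ Bs : Multiset (Finset (Fin v)), IsGenCover Finset.univ Bs k t m lam ∧
      Multiset.card Bs = genCoverNumber v k t m lam := by
  obtain ⟨Bs, h⟩ := exists_isGenCover (Finset.univ : Finset (Fin v)) lam htk (by simpa) htm
  exact Nat.sInf_mem (s := { b | ∃ Bs : Multiset (Finset (Fin v)),
    IsGenCover Finset.univ Bs k t m lam ∧ Multiset.card Bs = b }) ⟨_, Bs, h, rfl⟩

theorem sum_card_filter_mem {α : Type*} [DecidableEq α] {X : Finset α} {k : ℕ}
    (Bs : Multiset (Finset α)) (h : ∀ B ∈ Bs, B ⊆ X ∧ B.card = k) :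
    ∑ x ∈ X, (Bs.filter (x ∈ ·)).card = k * Bs.card := by
  induction Bs using Multiset.induction_on with
  | empty => simp
  | cons B Bs ih =>
    obtain ⟨hBX, hB⟩ := h B (Multiset.mem_cons_self _ _)
    have hsum : ∑ x ∈ X, (if x ∈ B then 1 else 0) = k := by
      rw [← hB, Finset.sum_ite_mem, Finset.inter_eq_right.2 hBX, Finset.card_eq_sum_ones]
    have hcons (x : α) : ((B ::ₘ Bs).filter (x ∈ ·)).card =
        (if x ∈ B then 1 else 0) + (Bs.filter (x ∈ ·)).card := by
      rw [Multiset.filter_cons, Multiset.card_add]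
      split_ifs <;> simp
    simp only [hcons]
    rw [Finset.sum_add_distrib, hsum, ih fun A hA => h A (Multiset.mem_cons_of_mem hA),
      Multiset.card_cons]
    ring

theorem exists_card_filter_mem_le {α : Type*} [DecidableEq α] {X : Finset α} {k : ℕ}
    (hX : X.Nonempty) (Bs : Multiset (Finset α)) (h : ∀ B ∈ Bs, B ⊆ X ∧ B.card = k) :
    ∃ x ∈ X, (Bs.filter (x ∈ ·)).card ≤ k * Bs.card / X.card := by
  obtain ⟨x, hx, hmin⟩ := X.exists_min_image (fun x => (Bs.filter (x ∈ ·)).card) hX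
  refine ⟨x, hx, (Nat.le_div_iff_mul_le hX.card_pos).2 ?_⟩
  rw [← sum_card_filter_mem Bs h, mul_comm]
  exact Finset.card_nsmul_le_sum X _ _ hmin

theorem card_filter_le_card_filter_bind {α β : Type*} (p : α → Prop) (q : β → Prop)
    [DecidablePred p] [DecidablePred q] (s : Multiset α) (g : α → Multiset β)
    (h : ∀ a ∈ s, p a → ∃ b ∈ g a, q b) :
    (s.filter p).card ≤ ((s.bind g).filter q).card := by
  induction s using Multiset.induction_on with
  | empty => simp
  | cons a s ih =>
    have ih := ih fun b hb => h b (Multiset.mem_cons_of_mem hb)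
    rw [Multiset.cons_bind, Multiset.filter_add, Multiset.card_add]
    by_cases ha : p a
    · obtain ⟨b, hb, hq⟩ := h a (Multiset.mem_cons_self _ _) ha
      have : 0 < ((g a).filter q).card :=
        Multiset.card_pos_iff_exists_mem.2 ⟨b, Multiset.mem_filter.2 ⟨hb, hq⟩⟩
      rw [Multiset.filter_cons_of_pos _ ha, Multiset.card_cons]
      omega
    · rw [Multiset.filter_cons_of_neg _ ha]
      omega

/-- The blocks obtained from `B` when the point `x` is spliced into the points of `insert x N`. -/
def spliceBlock {α : Type*} [DecidableEq α] (x : α) (N B : Finset α) : Multiset (Finset α) :=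
  if x ∈ B then (insert x N).val.map (fun y => insert y (B.erase x)) else {B}

theorem card_bind_spliceBlock {α : Type*} [DecidableEq α] {x : α} {N : Finset α} (hx : x ∉ N)
    (Bs : Multiset (Finset α)) :
    (Bs.bind (spliceBlock x N)).card = N.card * (Bs.filter (x ∈ ·)).card + Bs.card := by
  induction Bs using Multiset.induction_on with
  | empty => simp
  | cons B Bs ih =>
    rw [Multiset.cons_bind, Multiset.card_add, ih, spliceBlock]
    by_cases hB : x ∈ B
    · rw [if_pos hB, Multiset.card_map, Finset.card_val, Finset.card_insert_of_notMem hx,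
        Multiset.filter_cons_of_pos (p := (x ∈ ·)) _ hB, Multiset.card_cons, Multiset.card_cons]
      ring
    · rw [if_neg hB, Multiset.filter_cons_of_neg (p := (x ∈ ·)) _ hB, Multiset.card_cons,
        Multiset.card_singleton]
      ring

theorem subset_and_card_of_mem_spliceBlock {α : Type*} [DecidableEq α] {X N B A : Finset α} {x : α}
    (hN : Disjoint X N) (hB : B ⊆ X) (hA : A ∈ spliceBlock x N B) :
    A ⊆ X ∪ N ∧ A.card = B.card := by
  rw [spliceBlock] at hA
  split_ifs at hA with hxB
  · obtain ⟨y, hy, rfl⟩ := Multiset.mem_map.1 hA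
    have hyN : y = x ∨ y ∈ N := by simpa using hy
    have hyB : y ∉ B.erase x := by
      intro h
      rcases hyN with rfl | hyN
      · exact Finset.notMem_erase _ _ h
      · exact Finset.disjoint_left.1 hN (hB (Finset.mem_of_mem_erase h)) hyN
    refine ⟨Finset.insert_subset ?_ fun z hz =>
      Finset.mem_union_left _ (hB (Finset.mem_of_mem_erase hz)), ?_⟩
    · rcases hyN with rfl | hyN
      · exact Finset.mem_union_left _ (hB hxB)
      · exact Finset.mem_union_right _ hyN
    · rw [Finset.card_insert_of_notMem hyB, Finset.card_erase_add_one hxB]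
  · rw [Multiset.mem_singleton.1 hA]
    exact ⟨hB.trans Finset.subset_union_left, rfl⟩

/-- The point splicing construction. -/
theorem IsGenCover.splice {α : Type*} [DecidableEq α] {X N : Finset α} {x : α}
    {Bs Ds : Multiset (Finset α)} {k l t m lam : ℕ} (hB : IsGenCover X Bs k t m lam)
    (hD : IsGenCover (X.erase x) Ds l (t - 2) (m - 2) lam) (hx : x ∈ X) (hN : Disjoint X N)
    (hk : l + (N.card + 1) = k) (hm : m ≤ X.card) (hm2 : 2 ≤ m) :
    IsGenCover (X ∪ N) (Bs.bind (spliceBlock x N) + Ds.map (· ∪ insert x N)) k t m lam := by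
  have hxN : x ∉ N := Finset.disjoint_left.1 hN hx
  have hdisj : Disjoint (X.erase x) (insert x N) :=
    Finset.disjoint_insert_right.2
      ⟨Finset.notMem_erase _ _, hN.mono_left (Finset.erase_subset _ _)⟩
  refine ⟨fun A hA => ?_, fun M hM hcard => ?_⟩
  · rcases Multiset.mem_add.1 hA with hA | hA
    · obtain ⟨B, hBs, hA⟩ := Multiset.mem_bind.1 hA
      rw [← (hB.1 B hBs).2]
      exact subset_and_card_of_mem_spliceBlock hN (hB.1 B hBs).1 hA
    · obtain ⟨D, hDs, rfl⟩ := Multiset.mem_map.1 hA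
      obtain ⟨hDX, hDl⟩ := hD.1 D hDs
      refine ⟨Finset.union_subset_union (hDX.trans (Finset.erase_subset _ _)) subset_rfl |>.trans
        ?_, ?_⟩
      · intro z hz
        simp only [Finset.mem_union, Finset.mem_insert] at hz ⊢
        rcases hz with hz | rfl | hz <;> tauto
      · rw [Finset.card_union_of_disjoint (hdisj.mono_left hDX), hDl,
          Finset.card_insert_of_notMem hxN, hk]
  rw [Multiset.filter_add, Multiset.card_add]
  have hsplit : (M \ insert x N).card + (M ∩ insert x N).card = m := by
    rw [Finset.card_sdiff_add_card_inter, hcard]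
  have hsub : M \ insert x N ⊆ X.erase x := by
    intro z hz
    have := @hM z
    simp only [Finset.mem_sdiff, Finset.mem_insert, Finset.mem_union, Finset.mem_erase] at *
    tauto
  by_cases hs : 2 ≤ (M ∩ insert x N).card
  · refine le_add_left ?_
    obtain ⟨M', hMM', hM'X, hM'⟩ := Finset.exists_subsuperset_card_eq hsub
      (show (M \ insert x N).card ≤ m - 2 by omega)
      (show m - 2 ≤ (X.erase x).card by rw [Finset.card_erase_of_mem hx]; omega)
    refine (hD.2 M' hM'X hM').trans ?_
    rw [Multiset.filter_map, Multiset.card_map]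
    refine Multiset.card_le_card (Multiset.monotone_filter_right _ fun D hDt => ?_)
    have hcover : M' ∩ D ⊆ ((M \ insert x N) ∩ D) ∪ (M' \ (M \ insert x N)) := by
      intro z hz
      simp only [Finset.mem_inter, Finset.mem_union, Finset.mem_sdiff] at *
      tauto
    have h1 := (Finset.card_le_card hcover).trans (Finset.card_union_le _ _)
    rw [Finset.card_sdiff_of_subset hMM'] at h1
    have hinter : ((M \ insert x N) ∩ D) ∪ (M ∩ insert x N) ⊆ M ∩ (D ∪ insert x N) := by
      intro z hz
      simp only [Finset.mem_inter, Finset.mem_union, Finset.mem_sdiff] at *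
      tauto
    have h2 := Finset.card_le_card hinter
    rw [Finset.card_union_of_disjoint ((Finset.disjoint_sdiff_inter _ _).mono_left
      Finset.inter_subset_left)] at h2
    simp only [Function.comp_apply]
    omega
  refine le_add_right ?_
  by_cases hs0 : (M ∩ insert x N).card = 0
  · have hMY : Disjoint M (insert x N) := by
      rwa [Finset.disjoint_iff_inter_eq_empty, ← Finset.card_eq_zero]
    have hMX : M ⊆ X := by
      rw [Finset.sdiff_eq_self_of_disjoint hMY] at hsub
      exact hsub.trans (Finset.erase_subset _ _)
    refine (hB.2 M hMX hcard).trans (card_filter_le_card_filter_bind _ _ _ _ fun B _ ht => ?_)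
    refine ⟨B, ?_, ht⟩
    rw [spliceBlock]
    split_ifs with hxB
    · exact Multiset.mem_map.2 ⟨x, Finset.mem_insert_self _ _, Finset.insert_erase hxB⟩
    · exact Multiset.mem_singleton_self B
  · obtain ⟨y, hy⟩ := Finset.card_eq_one.1 (show (M ∩ insert x N).card = 1 by omega)
    obtain ⟨hyM, hyY⟩ := Finset.mem_inter.1 (hy ▸ Finset.mem_singleton_self y)
    have hxnot : x ∉ M \ insert x N := by simp
    have hynot : y ∉ M \ insert x N := by simp [-Finset.mem_insert, hyY]
    have hMins : insert y (M \ insert x N) ⊆ M :=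
      Finset.insert_subset hyM Finset.sdiff_subset
    have hM' : insert x (M \ insert x N) ⊆ X :=
      Finset.insert_subset hx (hsub.trans (Finset.erase_subset _ _))
    refine (hB.2 _ hM' (by rw [Finset.card_insert_of_notMem hxnot]; omega)).trans
      (card_filter_le_card_filter_bind _ _ _ _ fun B _ ht => ?_)
    by_cases hxB : x ∈ B
    · refine ⟨insert y (B.erase x), ?_, ?_⟩
      · rw [spliceBlock, if_pos hxB]
        exact Multiset.mem_map_of_mem _ hyY
      · rw [Finset.insert_inter_of_mem hxB,
          Finset.card_insert_of_notMem fun h => hxnot (Finset.mem_inter.1 h).1] at ht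
        refine ht.trans ?_
        rw [← Finset.card_insert_of_notMem fun h => hynot (Finset.mem_inter.1 h).1]
        refine Finset.card_le_card fun z hz => ?_
        rcases Finset.mem_insert.1 hz with rfl | hz
        · exact Finset.mem_inter.2 ⟨hyM, Finset.mem_insert_self _ _⟩
        · obtain ⟨hzM, hzB⟩ := Finset.mem_inter.1 hz
          exact Finset.mem_inter.2 ⟨(Finset.mem_sdiff.1 hzM).1, Finset.mem_insert_of_mem
            (Finset.mem_erase.2 ⟨fun h => hxnot (h ▸ hzM), hzB⟩)⟩
    · refine ⟨B, by simp [spliceBlock, hxB], ?_⟩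
      rw [Finset.insert_inter_of_notMem hxB] at ht
      exact ht.trans (Finset.card_le_card
        (Finset.inter_subset_inter_right Finset.sdiff_subset))

/-- Consequence of the point splicing construction:
`C_λ(v+n,k,t,m) ≤ n ⌊k C_λ(v,k,t,m) / v⌋ + C_λ(v,k,t,m) + C_λ(v-1, k-n-1, t-2, m-2)`. -/
theorem point_splicing_bound (v k t m lam n : ℕ)
    (ht : 2 < t) (hkt : t ≤ k) (hvk : k ≤ v) (hmt : t ≤ m) (hvm : m ≤ v)
    (hlam : 0 < lam) (hn : 1 ≤ n) (hnk : n ≤ k - t + 1) :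
    genCoverNumber (v + n) k t m lam ≤
      n * (k * genCoverNumber v k t m lam / v) + genCoverNumber v k t m lam +
        genCoverNumber (v - 1) (k - n - 1) (t - 2) (m - 2) lam := by
  obtain ⟨Bs, hBs, hBcard⟩ := exists_isGenCover_card_eq lam hkt hvk hmt
  obtain ⟨Ds, hDs, hDcard⟩ := exists_isGenCover_card_eq (v := v - 1) (k := k - n - 1)
    (t := t - 2) (m := m - 2) lam (by omega) (by omega) (by omega)
  let X : Finset (Fin (v + n)) := Finset.univ.map (Fin.castAddEmb n)
  have hX : X.card = v := by simp [X]
  have hB : IsGenCover X (Bs.map (Finset.map (Fin.castAddEmb n))) k t m lam := hBs.map _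
  obtain ⟨x, hx, hdeg⟩ := exists_card_filter_mem_le (Finset.card_pos.1 (by omega)) _ hB.1
  rw [Multiset.card_map, hBcard, hX] at hdeg
  have hXx : (X.erase x).card = v - 1 := by rw [Finset.card_erase_of_mem hx, hX]
  let f := ((X.erase x).orderEmbOfFin hXx).toEmbedding
  have hf : Finset.univ.map f = X.erase x := Finset.map_orderEmbOfFin_univ _ hXx
  have hD := hDs.map f
  rw [hf] at hD
  have hNcard : Xᶜ.card = n := by rw [Finset.card_compl, hX, Fintype.card_fin]; omega
  have key := hB.splice hD hx disjoint_compl_right (by omega) (by omega) (by omega)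
  rw [Finset.union_compl] at key
  refine (genCoverNumber_le key).trans ?_
  rw [Multiset.card_add, card_bind_spliceBlock (by simpa using hx), Multiset.card_map,
    Multiset.card_map, Multiset.card_map, hBcard, hDcard, hNcard]
  gcongr
end

section
/- Let k ≥ 5, let v ≥ k, and let v_{1,1}, v_{1,2}, v_{2,1}, v_{2,2}, v_{3,1}, v_{3,2} be nonnegative integers with Σ_{i=1}^{3} Σ_{j=1}^{2} v_{i,j} = v−1, such that each of the sums v_{1,1}+v_{2,1}, v_{1,2}+v_{2,2}, v_{1,1}+v_{2,2}, v_{1,2}+v_{2,1}, v_{3,1}+v_{3,2} is at least k−3 and each of v_{1,1}+v_{1,2}, v_{2,1}+v_{2,2}, v_{3,1}+v_{3,2} is at least k−2. Then C(v+3, k, 4, 6) ≤ 3·⌊k·C(v,k,4,6)/v⌋ + C(v,k,4,6) + C(v_{1,1}+v_{2,1}, k−3, 2) + C(v_{1,2}+v_{2,2}, k−3, 2) + C(v_{1,1}+v_{2,2}, k−3, 2) + C(v_{1,2}+v_{2,1}, k−3, 2) + C(v_{1,1}+v_{1,2}, k−2, 2) + C(v_{2,1}+v_{2,2}, k−2,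 2) + 2·C(v_{3,1}+v_{3,2}, k−3, 2) + C(v_{3,1}+v_{3,2}, k−2, 2). -/
/-- `(X, Bs)` is a `(|X|, k, t, m)` cover: `Bs` is a collection of `k`-subsets of `X` such that
every `m`-subset of `X` intersects at least one block of `Bs` in at least `t` points. -/
def IsCover {α : Type*} [DecidableEq α] (X : Finset α) (Bs : Finset (Finset α))
    (k t m : ℕ) : Prop :=
  (∀ B ∈ Bs, B ⊆ X ∧ B.card = k) ∧
  ∀ M ⊆ X, M.card = m → ∃ B ∈ Bs, t ≤ (M ∩ B).card

/-- The cover number `C(v,k,t,m)`: the minimum number of blocks of a `(v,k,t,m)` cover.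
The covering number `C(v,k,t)` is `C(v,k,t,t)`. -/
noncomputable def coverNumber (v k t m : ℕ) : ℕ :=
  sInf { b | ∃ Bs : Finset (Finset (Fin v)),
    IsCover Finset.univ Bs k t m ∧ Bs.card = b }

lemma exists_embedding_range_eq {α : Type*} (X : Finset α) :
    ∃ e : Fin X.card ↪ α, (∀ i, e i ∈ X) ∧ ∀ a ∈ X, ∃ i, e i = a := by
  refine ⟨X.equivFin.symm.toEmbedding.trans (Function.Embedding.subtype _),
    fun i => (X.equivFin.symm i).2, fun a ha => ⟨X.equivFin ⟨a, ha⟩, ?_⟩⟩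
  simp

/-- Pulling a cover back along a parametrization of its point set bounds the cover number. -/
lemma coverNumber_le_of_isCover {α : Type*} [DecidableEq α] {X : Finset α}
    {Bs : Finset (Finset α)} {v k t m : ℕ} (hX : X.card = v) (h : IsCover X Bs k t m) :
    coverNumber v k t m ≤ Bs.card := by
  subst hX
  obtain ⟨e, hmem, hsurj⟩ := exists_embedding_range_eq X
  let f : Finset α → Finset (Fin X.card) := fun B => Finset.univ.filter (fun i => e i ∈ B)
  have hmap : ∀ B ⊆ X, (f B).map e = B := by
    intro B hB
    ext a
    simp only [f, Finset.mem_map, Finset.mem_filter, Finset.mem_univ, true_and]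
    constructor
    · rintro ⟨i, hi, rfl⟩
      exact hi
    · intro ha
      obtain ⟨i, rfl⟩ := hsurj a (hB ha)
      exact ⟨i, ha, rfl⟩
  refine le_trans (Nat.sInf_le ⟨Bs.image f, ⟨?_, ?_⟩, rfl⟩) Finset.card_image_le
  · intro B' hB'
    obtain ⟨B, hB, rfl⟩ := Finset.mem_image.1 hB'
    refine ⟨Finset.subset_univ _, ?_⟩
    rw [← Finset.card_map e, hmap B (h.1 B hB).1, (h.1 B hB).2]
  · intro M _ hM
    obtain ⟨B, hB, hc⟩ := h.2 (M.map e)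
      (by
        intro a ha
        obtain ⟨i, -, rfl⟩ := Finset.mem_map.1 ha
        exact hmem i)
      (by rw [Finset.card_map, hM])
    refine ⟨f B, Finset.mem_image_of_mem f hB, ?_⟩
    rwa [← Finset.card_map e, Finset.map_inter, hmap B (h.1 B hB).1]

/-- For feasible parameters the cover number is attained on every point set of the right size. -/
lemma exists_isCover_card_eq_coverNumber {α : Type*} [DecidableEq α] {X : Finset α}
    {v k t m : ℕ} (hX : X.card = v) (hk : k ≤ v) (htk : t ≤ k) (htm : t ≤ m) :
    ∃ Bs : Finset (Finset α), IsCover X Bs k t m ∧ Bs.card = coverNumber v k t m := by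
  subst hX
  have hne : { b | ∃ Bs : Finset (Finset (Fin X.card)),
      IsCover Finset.univ Bs k t m ∧ Bs.card = b }.Nonempty := by
    refine ⟨_, Finset.powersetCard k Finset.univ, ⟨?_, ?_⟩, rfl⟩
    · intro B hB
      exact Finset.mem_powersetCard.1 hB
    · intro M _ hM
      obtain ⟨S, hSM, hS⟩ := Finset.exists_subset_card_eq (hM ▸ htm)
      obtain ⟨B, hSB, -, hB⟩ := Finset.exists_subsuperset_card_eq (Finset.subset_univ S)
        (hS ▸ htk) (by simpa using hk)
      refine ⟨B, Finset.mem_powersetCard.2 ⟨Finset.subset_univ _, hB⟩, ?_⟩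
      rw [← hS]
      exact Finset.card_le_card (Finset.subset_inter hSM hSB)
  obtain ⟨Bs, hBs, hcard⟩ := Nat.sInf_mem hne
  obtain ⟨e, hmem, hsurj⟩ := exists_embedding_range_eq X
  refine ⟨Bs.map (Finset.mapEmbedding e).toEmbedding, ⟨?_, ?_⟩, ?_⟩
  · intro B' hB'
    obtain ⟨B, hB, rfl⟩ := Finset.mem_map.1 hB'
    refine ⟨?_, ?_⟩
    · intro a ha
      obtain ⟨i, -, rfl⟩ := Finset.mem_map.1 ha
      exact hmem i
    · exact (Finset.card_map e).trans (hBs.1 B hB).2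
  · intro M hMX hM
    have hmap : (Finset.univ.filter (fun i => e i ∈ M)).map e = M := by
      ext a
      simp only [Finset.mem_map, Finset.mem_filter, Finset.mem_univ, true_and]
      constructor
      · rintro ⟨i, hi, rfl⟩
        exact hi
      · intro ha
        obtain ⟨i, rfl⟩ := hsurj a (hMX ha)
        exact ⟨i, ha, rfl⟩
    obtain ⟨B, hB, hc⟩ := hBs.2 (Finset.univ.filter (fun i => e i ∈ M)) (Finset.subset_univ _)
      (by rw [← Finset.card_map e, hmap, hM])
    refine ⟨B.map e, Finset.mem_map.2 ⟨B, hB, rfl⟩, ?_⟩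
    rwa [← Finset.card_map e, Finset.map_inter, hmap] at hc
  · rw [Finset.card_map, hcard]
    rfl

/-- Some point lies in at most the average number of blocks. -/
lemma exists_degree_le_average {α : Type*} [DecidableEq α] {X : Finset α}
    {Bs : Finset (Finset α)} {k : ℕ} (hX : X.Nonempty) (h : ∀ B ∈ Bs, B ⊆ X ∧ B.card = k) :
    ∃ x ∈ X, (Bs.filter (fun B => x ∈ B)).card ≤ k * Bs.card / X.card := by
  by_contra! hlt
  have hcount : ∑ x ∈ X, (Bs.filter (fun B => x ∈ B)).card = k * Bs.card := by
    refine (Finset.sum_card_bipartiteAbove_eq_sum_card_bipartiteBelow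
      (fun x (B : Finset α) => x ∈ B)).trans ?_
    rw [Finset.sum_congr rfl (g := fun _ => k), Finset.sum_const, smul_eq_mul, mul_comm]
    intro B hB
    rw [← (h B hB).2, Finset.bipartiteBelow, Finset.filter_mem_eq_inter,
      Finset.inter_eq_right.2 (h B hB).1]
  have hsum : X.card * (k * Bs.card / X.card + 1) ≤ k * Bs.card := by
    refine le_of_le_of_eq ?_ hcount
    rw [← smul_eq_mul]
    exact Finset.card_nsmul_le_sum _ _ _ hlt
  have := Nat.lt_mul_div_succ (k * Bs.card) hX.card_pos
  omega

/-- `a` and `b` lie together in one of the sets `U`, `V`, `W`. -/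
def SamePart {α : Type*} (U V W : Finset α) (a b : α) : Prop :=
  (a ∈ U ∧ b ∈ U) ∨ (a ∈ V ∧ b ∈ V) ∨ (a ∈ W ∧ b ∈ W)

lemma exists_samePart_of_four_le_card {α : Type*} [DecidableEq α] {U V W N : Finset α}
    (hN : N ⊆ U ∪ V ∪ W) (h : 4 ≤ N.card) :
    ∃ a ∈ N, ∃ b ∈ N, a ≠ b ∧ SamePart U V W a b := by
  let f : α → ℕ := fun a => if a ∈ U then 0 else if a ∈ V then 1 else 2
  obtain ⟨a, ha, b, hb, hab, hf⟩ := Finset.exists_ne_map_eq_of_card_lt_of_maps_to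
    (s := N) (t := Finset.range 3) (f := f) (by rw [Finset.card_range]; omega)
    (by intro a _; simp only [f, Finset.coe_range, Set.mem_Iio]; split_ifs <;> omega)
  have hUa := hN ha
  have hUb := hN hb
  simp only [Finset.mem_union] at hUa hUb
  refine ⟨a, ha, b, hb, hab, ?_⟩
  simp only [f] at hf
  unfold SamePart
  split_ifs at hf <;> tauto

/-- Adjoining a fixed set `T` to the blocks of pair covers of `U`, `V` and `W`. -/
lemma exists_adjoined_pairCovers {α : Type*} [DecidableEq α] {U V W T : Finset α} {k u v w : ℕ}
    (hk : 2 ≤ k) (hU : U.card = u) (hV : V.card = v) (hW : W.card = w)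
    (hu : k ≤ u) (hv : k ≤ v) (hw : k ≤ w) (hT : Disjoint (U ∪ V ∪ W) T) :
    ∃ G : Finset (Finset α),
      G.card ≤ coverNumber u k 2 2 + coverNumber v k 2 2 + coverNumber w k 2 2 ∧
      (∀ B ∈ G, B ⊆ U ∪ V ∪ W ∪ T ∧ B.card = k + T.card) ∧
      ∀ a b, a ≠ b → SamePart U V W a b → ∃ B ∈ G, T ⊆ B ∧ a ∈ B ∧ b ∈ B := by
  obtain ⟨D₁, h₁, c₁⟩ := exists_isCover_card_eq_coverNumber hU hu hk le_rfl
  obtain ⟨D₂, h₂, c₂⟩ := exists_isCover_card_eq_coverNumber hV hv hk le_rfl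
  obtain ⟨D₃, h₃, c₃⟩ := exists_isCover_card_eq_coverNumber hW hw hk le_rfl
  have hD : ∀ B ∈ D₁ ∪ D₂ ∪ D₃, B ⊆ U ∪ V ∪ W ∧ B.card = k := by
    intro B hB
    simp only [Finset.mem_union] at hB
    rcases hB with (hB | hB) | hB
    · exact ⟨(h₁.1 B hB).1.trans (by grind), (h₁.1 B hB).2⟩
    · exact ⟨(h₂.1 B hB).1.trans (by grind), (h₂.1 B hB).2⟩
    · exact ⟨(h₃.1 B hB).1.trans (by grind), (h₃.1 B hB).2⟩
  have hpair : ∀ (Z : Finset α) (D : Finset (Finset α)), IsCover Z D k 2 2 →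
      ∀ a b, a ≠ b → a ∈ Z → b ∈ Z → ∃ B ∈ D, a ∈ B ∧ b ∈ B := by
    intro Z D h a b hab ha hb
    obtain ⟨B, hB, hc⟩ := h.2 {a, b} (by grind) (Finset.card_pair hab)
    have hsub : {a, b} ∩ B = {a, b} :=
      Finset.eq_of_subset_of_card_le Finset.inter_subset_left (by rwa [Finset.card_pair hab])
    exact ⟨B, hB, by grind, by grind⟩
  refine ⟨(D₁ ∪ D₂ ∪ D₃).image (· ∪ T), ?_, ?_, ?_⟩
  · have := Finset.card_union_le (D₁ ∪ D₂) D₃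
    have := Finset.card_union_le D₁ D₂
    have : ((D₁ ∪ D₂ ∪ D₃).image (· ∪ T)).card ≤ _ := Finset.card_image_le
    omega
  · intro B' hB'
    obtain ⟨B, hB, rfl⟩ := Finset.mem_image.1 hB'
    refine ⟨Finset.union_subset_union_left (hD B hB).1, ?_⟩
    rw [Finset.card_union_of_disjoint (Finset.disjoint_of_subset_left (hD B hB).1 hT),
      (hD B hB).2]
  · intro a b hab hS
    have : ∃ B ∈ D₁ ∪ D₂ ∪ D₃, a ∈ B ∧ b ∈ B := by
      rcases hS with ⟨ha, hb⟩ | ⟨ha, hb⟩ | ⟨ha, hb⟩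
      · obtain ⟨B, hB, h⟩ := hpair U D₁ h₁ a b hab ha hb
        exact ⟨B, by grind, h⟩
      · obtain ⟨B, hB, h⟩ := hpair V D₂ h₂ a b hab ha hb
        exact ⟨B, by grind, h⟩
      · obtain ⟨B, hB, h⟩ := hpair W D₃ h₃ a b hab ha hb
        exact ⟨B, by grind, h⟩
    obtain ⟨B, hB, ha, hb⟩ := this
    exact ⟨B ∪ T, Finset.mem_image_of_mem _ hB, Finset.subset_union_right,
      Finset.mem_union_left _ ha, Finset.mem_union_left _ hb⟩

lemma exists_samePart_ne {α : Type*} {U V W : Finset α} {a : α} [DecidableEq α]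
    (hU : 2 ≤ U.card) (hV : 2 ≤ V.card) (hW : 2 ≤ W.card) (ha : a ∈ U ∪ V ∪ W) :
    ∃ b, a ≠ b ∧ SamePart U V W a b := by
  simp only [Finset.mem_union] at ha
  rcases ha with (ha | ha) | ha
  · obtain ⟨b, hb, hne⟩ := Finset.exists_mem_ne hU a
    exact ⟨b, hne.symm, Or.inl ⟨ha, hb⟩⟩
  · obtain ⟨b, hb, hne⟩ := Finset.exists_mem_ne hV a
    exact ⟨b, hne.symm, Or.inr (Or.inl ⟨ha, hb⟩)⟩
  · obtain ⟨b, hb, hne⟩ := Finset.exists_mem_ne hW a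
    exact ⟨b, hne.symm, Or.inr (Or.inr ⟨ha, hb⟩)⟩

/-- Replacing the point `x` of a block by `y`: the new block meets `insert y N` at least as often
as the old one meets `insert x N`. -/
lemma card_insert_inter_le_swap {α : Type*} [DecidableEq α] {N B : Finset α} {x y : α}
    (hx : x ∉ N) (hy : y ∉ N) (hxB : x ∈ B) :
    (insert x N ∩ B).card ≤ (insert y N ∩ insert y (B.erase x)).card := by
  have h₁ : insert x N ∩ B = insert x (N ∩ B) := by grind
  have h₂ : insert y (N ∩ B) ⊆ insert y N ∩ insert y (B.erase x) := by grind
  calc (insert x N ∩ B).card = (insert y (N ∩ B)).card := by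
        rw [h₁, Finset.card_insert_of_notMem (by grind), Finset.card_insert_of_notMem (by grind)]
    _ ≤ _ := Finset.card_le_card h₂

lemma four_le_card_inter {α : Type*} [DecidableEq α] {M B : Finset α} {a b c d : α}
    (hab : a ≠ b) (hac : a ≠ c) (had : a ≠ d) (hbc : b ≠ c) (hbd : b ≠ d) (hcd : c ≠ d)
    (ha : a ∈ M ∩ B) (hb : b ∈ M ∩ B) (hc : c ∈ M ∩ B) (hd : d ∈ M ∩ B) :
    4 ≤ (M ∩ B).card := by
  have h : ({a, b, c, d} : Finset α).card = 4 := by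
    rw [Finset.card_insert_of_notMem (by grind), Finset.card_insert_of_notMem (by grind),
      Finset.card_pair hcd]
  rw [← h]
  exact Finset.card_le_card (by grind)

lemma exists_block_of_pair {α : Type*} [DecidableEq α] {F : Finset (Finset α)}
    {M N T : Finset α} {p q : α} (hNM : N ⊆ M) (hpq : p ≠ q) (hp : p ∈ M) (hq : q ∈ M)
    (hpN : p ∉ N) (hqN : q ∉ N) (hpT : p ∈ T) (hqT : q ∈ T)
    (h : ∃ a ∈ N, ∃ b ∈ N, a ≠ b ∧ ∃ B ∈ F, T ⊆ B ∧ a ∈ B ∧ b ∈ B) :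
    ∃ B ∈ F, 4 ≤ (M ∩ B).card := by
  obtain ⟨a, ha, b, hb, hab, B, hB, hT, haB, hbB⟩ := h
  exact ⟨B, hB, four_le_card_inter hpq
    (ne_of_mem_of_not_mem ha hpN).symm (ne_of_mem_of_not_mem hb hpN).symm
    (ne_of_mem_of_not_mem ha hqN).symm (ne_of_mem_of_not_mem hb hqN).symm hab
    (Finset.mem_inter.2 ⟨hp, hT hpT⟩) (Finset.mem_inter.2 ⟨hq, hT hqT⟩)
    (Finset.mem_inter.2 ⟨hNM ha, haB⟩) (Finset.mem_inter.2 ⟨hNM hb, hbB⟩)⟩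

lemma exists_block_of_triple {α : Type*} [DecidableEq α] {F : Finset (Finset α)}
    {M N : Finset α} {p q r : α} (hNM : N ⊆ M) (hpq : p ≠ q) (hpr : p ≠ r) (hqr : q ≠ r)
    (hp : p ∈ M) (hq : q ∈ M) (hr : r ∈ M) (hpN : p ∉ N) (hqN : q ∉ N) (hrN : r ∉ N)
    (h : ∃ a ∈ N, ∃ B ∈ F, {p, q, r} ⊆ B ∧ a ∈ B) :
    ∃ B ∈ F, 4 ≤ (M ∩ B).card := by
  obtain ⟨a, ha, B, hB, hT, haB⟩ := h
  exact ⟨B, hB, four_le_card_inter hpq hpr (ne_of_mem_of_not_mem ha hpN).symm hqr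
    (ne_of_mem_of_not_mem ha hqN).symm (ne_of_mem_of_not_mem ha hrN).symm
    (Finset.mem_inter.2 ⟨hp, hT (by simp)⟩) (Finset.mem_inter.2 ⟨hq, hT (by simp)⟩)
    (Finset.mem_inter.2 ⟨hr, hT (by simp)⟩) (Finset.mem_inter.2 ⟨hNM ha, haB⟩)⟩

/-- Among three points, two share a part of one of the three ways to pair up `P, Q, R, S`. -/
lemma exists_samePart_of_three_le_card {α : Type*} [DecidableEq α] {P Q R S Z N : Finset α}
    (hN : N ⊆ P ∪ Q ∪ R ∪ S ∪ Z) (h : 3 ≤ N.card) :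
    ∃ a ∈ N, ∃ b ∈ N, a ≠ b ∧
      (SamePart (P ∪ R) (Q ∪ S) Z a b ∨ SamePart (P ∪ S) (Q ∪ R) Z a b ∨
        SamePart (P ∪ Q) (R ∪ S) Z a b) := by
  obtain ⟨a, b, c, ha, hb, hc, hab, hac, hbc⟩ := Finset.two_lt_card_iff.1 h
  have key : ∀ a ∈ N, ∀ b ∈ N, (a ∉ Z ∧ b ∉ Z) ∨ (a ∈ Z ∧ b ∈ Z) →
      SamePart (P ∪ R) (Q ∪ S) Z a b ∨ SamePart (P ∪ S) (Q ∪ R) Z a b ∨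
        SamePart (P ∪ Q) (R ∪ S) Z a b := by
    intro a ha b hb hab
    have haY := hN ha
    have hbY := hN hb
    simp only [SamePart, Finset.mem_union] at haY hbY ⊢
    clear hN h ha hb
    rcases haY with (((h | h) | h) | h) | h <;> rcases hbY with (((h' | h') | h') | h') | h' <;>
      simp_all
  by_cases hZ : (a ∉ Z ∧ b ∉ Z) ∨ (a ∈ Z ∧ b ∈ Z)
  · exact ⟨a, ha, b, hb, hab, key a ha b hb hZ⟩
  by_cases hZ' : (a ∉ Z ∧ c ∉ Z) ∨ (a ∈ Z ∧ c ∈ Z)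
  · exact ⟨a, ha, c, hc, hac, key a ha c hc hZ'⟩
  exact ⟨b, hb, c, hc, hbc, key b hb c hc (by tauto)⟩

lemma card_eq_card_inter_add_of_subset {α : Type*} [DecidableEq α] {M Y : Finset α}
    {x₁ x₂ x₃ x₄ : α} (h12 : x₁ ≠ x₂) (h13 : x₁ ≠ x₃) (h14 : x₁ ≠ x₄) (h23 : x₂ ≠ x₃)
    (h24 : x₂ ≠ x₄) (h34 : x₃ ≠ x₄) (hx₁ : x₁ ∉ Y) (hx₂ : x₂ ∉ Y) (hx₃ : x₃ ∉ Y)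
    (hx₄ : x₄ ∉ Y) (hM : M ⊆ Y ∪ {x₁, x₂, x₃, x₄}) :
    M.card = (M ∩ Y).card + ((if x₁ ∈ M then 1 else 0) + (if x₂ ∈ M then 1 else 0) +
      (if x₃ ∈ M then 1 else 0) + (if x₄ ∈ M then 1 else 0)) := by
  have hdisj : Disjoint (M ∩ Y) (M ∩ {x₁, x₂, x₃, x₄}) := by
    rw [Finset.disjoint_left]
    grind
  have hunion : M = (M ∩ Y) ∪ (M ∩ {x₁, x₂, x₃, x₄}) := by
    rw [← Finset.inter_union_distrib_left, Finset.inter_eq_left.2 hM]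
  conv_lhs => rw [hunion]
  rw [Finset.card_union_of_disjoint hdisj, Finset.inter_comm M {x₁, x₂, x₃, x₄},
    ← Finset.filter_mem_eq_inter (s := {x₁, x₂, x₃, x₄}),
    Finset.card_filter (· ∈ M) {x₁, x₂, x₃, x₄},
    Finset.sum_insert (by grind), Finset.sum_insert (by grind), Finset.sum_insert (by grind),
    Finset.sum_singleton]
  ring

/-- The covering condition for the spliced system. -/
lemma exists_block_of_spliced {α : Type*} [DecidableEq α] {F : Finset (Finset α)}
    {P Q R S Z : Finset α} {x₁ x₂ x₃ x₄ : α}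
    (h12 : x₁ ≠ x₂) (h13 : x₁ ≠ x₃) (h14 : x₁ ≠ x₄) (h23 : x₂ ≠ x₃) (h24 : x₂ ≠ x₄)
    (h34 : x₃ ≠ x₄)
    (hx₁ : x₁ ∉ P ∪ Q ∪ R ∪ S ∪ Z) (hx₂ : x₂ ∉ P ∪ Q ∪ R ∪ S ∪ Z)
    (hx₃ : x₃ ∉ P ∪ Q ∪ R ∪ S ∪ Z) (hx₄ : x₄ ∉ P ∪ Q ∪ R ∪ S ∪ Z)
    (hzero : ∀ N ⊆ P ∪ Q ∪ R ∪ S ∪ Z, N.card = 6 → ∃ B ∈ F, 4 ≤ (N ∩ B).card)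
    (hone : ∀ y ∈ ({x₁, x₂, x₃, x₄} : Finset α), ∀ N ⊆ P ∪ Q ∪ R ∪ S ∪ Z, N.card = 5 →
      ∃ B ∈ F, 4 ≤ (insert y N ∩ B).card)
    (hA : ∀ a b, a ≠ b → SamePart (P ∪ R) (Q ∪ S) Z a b →
      ∃ B ∈ F, {x₁, x₂, x₃} ⊆ B ∧ a ∈ B ∧ b ∈ B)
    (hB : ∀ a b, a ≠ b → SamePart (P ∪ S) (Q ∪ R) Z a b →
      ∃ B ∈ F, {x₁, x₂, x₄} ⊆ B ∧ a ∈ B ∧ b ∈ B)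
    (hC : ∀ a b, a ≠ b → SamePart (P ∪ Q) (R ∪ S) Z a b →
      ∃ B ∈ F, {x₃, x₄} ⊆ B ∧ a ∈ B ∧ b ∈ B)
    (hA' : ∀ a ∈ P ∪ Q ∪ R ∪ S ∪ Z, ∃ B ∈ F, {x₁, x₂, x₃} ⊆ B ∧ a ∈ B)
    (hB' : ∀ a ∈ P ∪ Q ∪ R ∪ S ∪ Z, ∃ B ∈ F, {x₁, x₂, x₄} ⊆ B ∧ a ∈ B)
    {M : Finset α} (hM : M ⊆ P ∪ Q ∪ R ∪ S ∪ Z ∪ {x₁, x₂, x₃, x₄}) (hM6 : M.card = 6) :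
    ∃ B ∈ F, 4 ≤ (M ∩ B).card := by
  have hcard := card_eq_card_inter_add_of_subset h12 h13 h14 h23 h24 h34 hx₁ hx₂ hx₃ hx₄ hM
  obtain ⟨N, hN⟩ : ∃ N, N = M ∩ (P ∪ Q ∪ R ∪ S ∪ Z) := ⟨_, rfl⟩
  have hNM : N ⊆ M := hN ▸ Finset.inter_subset_left
  have hNY : N ⊆ P ∪ Q ∪ R ∪ S ∪ Z := hN ▸ Finset.inter_subset_right
  rw [← hN, hM6] at hcard
  have n1 : x₁ ∉ N := fun h => hx₁ (hNY h)
  have n2 : x₂ ∉ N := fun h => hx₂ (hNY h)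
  have n3 : x₃ ∉ N := fun h => hx₃ (hNY h)
  have n4 : x₄ ∉ N := fun h => hx₄ (hNY h)
  have four_A : 4 ≤ N.card → ∃ a ∈ N, ∃ b ∈ N, a ≠ b ∧
      ∃ B ∈ F, {x₁, x₂, x₃} ⊆ B ∧ a ∈ B ∧ b ∈ B := fun h => by
    obtain ⟨a, ha, b, hb, hab, hs⟩ := exists_samePart_of_four_le_card
      (U := P ∪ R) (V := Q ∪ S) (W := Z) (hNY.trans (by clear * -; grind)) h
    exact ⟨a, ha, b, hb, hab, hA a b hab hs⟩
  have four_B : 4 ≤ N.card → ∃ a ∈ N, ∃ b ∈ N, a ≠ b ∧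
      ∃ B ∈ F, {x₁, x₂, x₄} ⊆ B ∧ a ∈ B ∧ b ∈ B := fun h => by
    obtain ⟨a, ha, b, hb, hab, hs⟩ := exists_samePart_of_four_le_card
      (U := P ∪ S) (V := Q ∪ R) (W := Z) (hNY.trans (by clear * -; grind)) h
    exact ⟨a, ha, b, hb, hab, hB a b hab hs⟩
  have four_C : 4 ≤ N.card → ∃ a ∈ N, ∃ b ∈ N, a ≠ b ∧
      ∃ B ∈ F, {x₃, x₄} ⊆ B ∧ a ∈ B ∧ b ∈ B := fun h => by
    obtain ⟨a, ha, b, hb, hab, hs⟩ := exists_samePart_of_four_le_card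
      (U := P ∪ Q) (V := R ∪ S) (W := Z) (hNY.trans (by clear * -; grind)) h
    exact ⟨a, ha, b, hb, hab, hC a b hab hs⟩
  have three : ∀ p, p ∉ N → p ≠ x₃ → p ≠ x₄ → p ∈ ({x₁, x₂} : Finset α) → p ∈ M → x₃ ∈ M →
      x₄ ∈ M → 3 ≤ N.card → ∃ B ∈ F, 4 ≤ (M ∩ B).card := by
    intro p hpN hp3 hp4 hp hpM m3 m4 h
    rw [Finset.mem_insert, Finset.mem_singleton] at hp
    obtain ⟨a, ha, b, hb, hab, hs⟩ := exists_samePart_of_three_le_card hNY h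
    rcases hs with hs | hs | hs
    · exact exists_block_of_pair hNM hp3 hpM m3 hpN n3 (by rcases hp with hp | hp <;> simp [hp]) (by simp)
        ⟨a, ha, b, hb, hab, hA a b hab hs⟩
    · exact exists_block_of_pair hNM hp4 hpM m4 hpN n4 (by rcases hp with hp | hp <;> simp [hp]) (by simp)
        ⟨a, ha, b, hb, hab, hB a b hab hs⟩
    · exact exists_block_of_pair hNM h34 m3 m4 n3 n4 (by simp) (by simp)
        ⟨a, ha, b, hb, hab, hC a b hab hs⟩
  have one : ∀ y ∈ ({x₁, x₂, x₃, x₄} : Finset α), y ∈ M → N.card = 5 →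
      ∃ B ∈ F, 4 ≤ (M ∩ B).card := by
    intro y hy hyM h
    obtain ⟨B, hBF, hc⟩ := hone y hy N hNY h
    exact ⟨B, hBF, hc.trans (Finset.card_le_card
      (Finset.inter_subset_inter_right (Finset.insert_subset hyM hNM)))⟩
  have hne : 0 < N.card → ∃ a ∈ N, a ∈ P ∪ Q ∪ R ∪ S ∪ Z := fun h =>
    (Finset.card_pos.1 h).imp fun a ha => ⟨ha, hNY ha⟩
  have triple_A : 0 < N.card → ∃ a ∈ N, ∃ B ∈ F, {x₁, x₂, x₃} ⊆ B ∧ a ∈ B := fun h =>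
    (hne h).imp fun a ha => ⟨ha.1, hA' a ha.2⟩
  have triple_B : 0 < N.card → ∃ a ∈ N, ∃ B ∈ F, {x₁, x₂, x₄} ⊆ B ∧ a ∈ B := fun h =>
    (hne h).imp fun a ha => ⟨ha.1, hB' a ha.2⟩
  by_cases m1 : x₁ ∈ M <;> by_cases m2 : x₂ ∈ M <;> by_cases m3 : x₃ ∈ M <;>
    by_cases m4 : x₄ ∈ M <;> simp only [m1, m2, m3, m4, if_true, if_false] at hcard
  · exact exists_block_of_triple hNM h12 h13 h23 m1 m2 m3 n1 n2 n3 (triple_A (by omega))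
  · exact exists_block_of_triple hNM h12 h13 h23 m1 m2 m3 n1 n2 n3 (triple_A (by omega))
  · exact exists_block_of_triple hNM h12 h14 h24 m1 m2 m4 n1 n2 n4 (triple_B (by omega))
  · exact exists_block_of_pair hNM h12 m1 m2 n1 n2 (by simp) (by simp) (four_A (by omega))
  · exact three x₁ n1 h13 h14 (by simp) m1 m3 m4 (by omega)
  · exact exists_block_of_pair hNM h13 m1 m3 n1 n3 (by simp) (by simp) (four_A (by omega))
  · exact exists_block_of_pair hNM h14 m1 m4 n1 n4 (by simp) (by simp) (four_B (by omega))
  · exact one x₁ (by simp) m1 (by omega)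
  · exact three x₂ n2 h23 h24 (by simp) m2 m3 m4 (by omega)
  · exact exists_block_of_pair hNM h23 m2 m3 n2 n3 (by simp) (by simp) (four_A (by omega))
  · exact exists_block_of_pair hNM h24 m2 m4 n2 n4 (by simp) (by simp) (four_B (by omega))
  · exact one x₂ (by simp) m2 (by omega)
  · exact exists_block_of_pair hNM h34 m3 m4 n3 n4 (by simp) (by simp) (four_C (by omega))
  · exact one x₃ (by simp) m3 (by omega)
  · exact one x₄ (by simp) m4 (by omega)
  · obtain ⟨B, hBF, hc⟩ := hzero N hNY (by omega)
    exact ⟨B, hBF, hc.trans (Finset.card_le_card (Finset.inter_subset_inter_right hNM))⟩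

/-- Splicing: replace the point `x` by itself and three new points, in all blocks through `x`. -/
lemma exists_spliced_blocks {α : Type*} [DecidableEq α] {Y : Finset α} {Bs : Finset (Finset α)}
    {k : ℕ} {x y₁ y₂ y₃ : α} (hx : x ∉ Y) (hy₁ : y₁ ∉ Y) (hy₂ : y₂ ∉ Y) (hy₃ : y₃ ∉ Y)
    (h : IsCover (insert x Y) Bs k 4 6) :
    ∃ G : Finset (Finset α),
      G.card ≤ 3 * (Bs.filter (fun B => x ∈ B)).card + Bs.card ∧
      (∀ B ∈ G, B ⊆ Y ∪ {x, y₁, y₂, y₃} ∧ B.card = k) ∧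
      (∀ N ⊆ Y, N.card = 6 → ∃ B ∈ G, 4 ≤ (N ∩ B).card) ∧
      ∀ y ∈ ({x, y₁, y₂, y₃} : Finset α), ∀ N ⊆ Y, N.card = 5 →
        ∃ B ∈ G, 4 ≤ (insert y N ∩ B).card := by
  let D := Bs.filter (fun B => x ∈ B)
  let c : α → Finset (Finset α) := fun y => D.image (fun B => insert y (B.erase x))
  have hc : ∀ y, (c y).card ≤ D.card := fun y => Finset.card_image_le
  have hcB : ∀ y ∉ Y, ∀ B ∈ c y, B ⊆ insert y Y ∧ B.card = k := by
    intro y hy B' hB'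
    obtain ⟨B, hB, rfl⟩ := Finset.mem_image.1 hB'
    obtain ⟨hBs, hxB⟩ := Finset.mem_filter.1 hB
    have hsub : B.erase x ⊆ Y := Finset.subset_insert_iff.1 (h.1 B hBs).1
    refine ⟨Finset.insert_subset_insert _ hsub, ?_⟩
    rw [Finset.card_insert_of_notMem (fun hmem => hy (hsub hmem)),
      Finset.card_erase_add_one hxB, (h.1 B hBs).2]
  refine ⟨Bs ∪ c y₁ ∪ c y₂ ∪ c y₃, ?_, ?_, ?_, ?_⟩
  · have := Finset.card_union_le (Bs ∪ c y₁ ∪ c y₂) (c y₃)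
    have := Finset.card_union_le (Bs ∪ c y₁) (c y₂)
    have := Finset.card_union_le Bs (c y₁)
    have := hc y₁
    have := hc y₂
    have := hc y₃
    simp only [D] at *
    omega
  · intro B hB
    simp only [Finset.mem_union] at hB
    rcases hB with ((hB | hB) | hB) | hB
    · exact ⟨(h.1 B hB).1.trans (by clear * -; grind), (h.1 B hB).2⟩
    · exact ⟨(hcB _ hy₁ B hB).1.trans (by clear * -; grind), (hcB _ hy₁ B hB).2⟩
    · exact ⟨(hcB _ hy₂ B hB).1.trans (by clear * -; grind), (hcB _ hy₂ B hB).2⟩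
    · exact ⟨(hcB _ hy₃ B hB).1.trans (by clear * -; grind), (hcB _ hy₃ B hB).2⟩
  · intro N hN h6
    obtain ⟨B, hB, h4⟩ := h.2 N (hN.trans (Finset.subset_insert _ _)) h6
    exact ⟨B, by simp only [Finset.mem_union]; tauto, h4⟩
  · intro y hy N hN h5
    have hxN : x ∉ N := fun hmem => hx (hN hmem)
    obtain ⟨B, hB, h4⟩ := h.2 (insert x N) (Finset.insert_subset_insert _ hN)
      (by rw [Finset.card_insert_of_notMem hxN, h5])
    by_cases hxB : x ∈ B
    · have hyN : y ∉ N := by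
        intro hmem
        have := hN hmem
        simp only [Finset.mem_insert, Finset.mem_singleton] at hy
        rcases hy with rfl | rfl | rfl | rfl <;> contradiction
      refine ⟨insert y (B.erase x), ?_, h4.trans (card_insert_inter_le_swap hxN hyN hxB)⟩
      have hmem : ∀ z, insert z (B.erase x) ∈ c z := fun z =>
        Finset.mem_image_of_mem _ (Finset.mem_filter.2 ⟨hB, hxB⟩)
      simp only [Finset.mem_insert, Finset.mem_singleton] at hy
      simp only [Finset.mem_union]
      rcases hy with rfl | rfl | rfl | rfl
      · rw [Finset.insert_erase hxB]
        tauto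
      · exact Or.inl (Or.inl (Or.inr (hmem _)))
      · exact Or.inl (Or.inr (hmem _))
      · exact Or.inr (hmem _)
    · refine ⟨B, by simp only [Finset.mem_union]; tauto, ?_⟩
      rw [Finset.insert_inter_of_notMem hxB] at h4
      exact h4.trans (Finset.card_le_card
        (Finset.inter_subset_inter_right (Finset.subset_insert _ _)))

lemma exists_disjoint_union_of_card_eq_add {α : Type*} [DecidableEq α] {Y : Finset α} {a b : ℕ}
    (h : Y.card = a + b) :
    ∃ P Q : Finset α, P.card = a ∧ Q.card = b ∧ Disjoint P Q ∧ P ∪ Q = Y := by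
  obtain ⟨P, hPY, hP⟩ := Finset.exists_subset_card_eq (show a ≤ Y.card by omega)
  refine ⟨P, Y \ P, hP, ?_, Finset.disjoint_sdiff, Finset.union_sdiff_of_subset hPY⟩
  rw [Finset.card_sdiff_of_subset hPY]
  omega

/-- Upper bound arising from the point splicing construction for `(v,k,4,6)` covers:
`C(v+3,k,4,6) ≤ 3⌊kC(v,k,4,6)/v⌋ + C(v,k,4,6) + (sum of pairwise `(·, k-3, 2)` and
`(·, k-2, 2)` covering numbers over the parts)`. Here `C(u,k',2) = coverNumber u k' 2 2`. -/
theorem splicing_bound_446 (v k v11 v12 v21 v22 v31 v32 : ℕ)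
    (hk : 5 ≤ k) (hv : k ≤ v)
    (hsum : v11 + v12 + v21 + v22 + v31 + v32 = v - 1)
    (h1 : k - 3 ≤ v11 + v21) (h2 : k - 3 ≤ v12 + v22)
    (h3 : k - 3 ≤ v11 + v22) (h4 : k - 3 ≤ v12 + v21)
    (h5 : k - 3 ≤ v31 + v32)
    (h6 : k - 2 ≤ v11 + v12) (h7 : k - 2 ≤ v21 + v22) (h8 : k - 2 ≤ v31 + v32) :
    coverNumber (v + 3) k 4 6 ≤
      3 * (k * coverNumber v k 4 6 / v) + coverNumber v k 4 6 +
        coverNumber (v11 + v21) (k - 3) 2 2 + coverNumber (v12 + v22) (k - 3) 2 2 +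
        coverNumber (v11 + v22) (k - 3) 2 2 + coverNumber (v12 + v21) (k - 3) 2 2 +
        coverNumber (v11 + v12) (k - 2) 2 2 + coverNumber (v21 + v22) (k - 2) 2 2 +
        2 * coverNumber (v31 + v32) (k - 3) 2 2 + coverNumber (v31 + v32) (k - 2) 2 2 := by
  have hv0 : 0 < v := by omega
  have hbase : (Finset.range v).card = v := Finset.card_range v
  obtain ⟨Bs, hBs, hBsc⟩ := exists_isCover_card_eq_coverNumber (t := 4) (m := 6) hbase hv
    (by omega) (by omega)
  obtain ⟨x, hxv, hdeg⟩ := exists_degree_le_average ⟨0, Finset.mem_range.2 hv0⟩ hBs.1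
  rw [hbase, hBsc] at hdeg
  obtain ⟨Y, hY⟩ : ∃ Y, Y = (Finset.range v).erase x := ⟨_, rfl⟩
  have hx₁ : x ∉ Y := by simp [hY]
  have hx₂ : v ∉ Y := by simp [hY]
  have hx₃ : v + 1 ∉ Y := by simp [hY]
  have hx₄ : v + 2 ∉ Y := by simp [hY]
  have hYc : Y.card = v - 1 := by rw [hY, Finset.card_erase_of_mem hxv, hbase]
  rw [← Finset.insert_erase hxv, ← hY] at hBs
  rw [Finset.mem_range] at hxv
  obtain ⟨G, hGc, hG, hzero, hone⟩ := exists_spliced_blocks hx₁ hx₂ hx₃ hx₄ hBs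
  obtain ⟨W, Z, hW, hZ, hWZ, hWZY⟩ := exists_disjoint_union_of_card_eq_add
    (Y := Y) (a := v11 + v12 + v21 + v22) (b := v31 + v32) (by omega)
  obtain ⟨U, S, hU, hS, hUS, hUSW⟩ := exists_disjoint_union_of_card_eq_add
    (Y := W) (a := v11 + v12 + v21) (b := v22) hW
  obtain ⟨V, R, hV, hR, hVR, hVRU⟩ := exists_disjoint_union_of_card_eq_add
    (Y := U) (a := v11 + v12) (b := v21) hU
  obtain ⟨P, Q, hP, hQ, hPQ, hPQV⟩ := exists_disjoint_union_of_card_eq_add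
    (Y := V) (a := v11) (b := v12) hV
  subst hPQV hVRU hUSW
  simp only [Finset.disjoint_union_left] at hUS hVR
  have hYA : P ∪ R ∪ (Q ∪ S) ∪ Z = Y := by rw [← hWZY]; clear * -; grind
  have hYB : P ∪ S ∪ (Q ∪ R) ∪ Z = Y := by rw [← hWZY]; clear * -; grind
  have hYC : P ∪ Q ∪ (R ∪ S) ∪ Z = Y := by rw [← hWZY]; clear * -; grind
  have hTA : Disjoint Y {x, v, v + 1} := by simp [hx₁, hx₂, hx₃]
  have hTB : Disjoint Y {x, v, v + 2} := by simp [hx₁, hx₂, hx₄]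
  have hTC : Disjoint Y {v + 1, v + 2} := by simp [hx₃, hx₄]
  have hcA : ({x, v, v + 1} : Finset ℕ).card = 3 :=
    Finset.card_eq_three.2 ⟨x, v, v + 1, by omega, by omega, by omega, rfl⟩
  have hcB : ({x, v, v + 2} : Finset ℕ).card = 3 :=
    Finset.card_eq_three.2 ⟨x, v, v + 2, by omega, by omega, by omega, rfl⟩
  have hcC : ({v + 1, v + 2} : Finset ℕ).card = 2 := Finset.card_pair (by omega)
  have cPR : (P ∪ R).card = v11 + v21 := by rw [Finset.card_union_of_disjoint hVR.1, hP, hR]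
  have cQS : (Q ∪ S).card = v12 + v22 := by rw [Finset.card_union_of_disjoint hUS.1.2, hQ, hS]
  have cPS : (P ∪ S).card = v11 + v22 := by rw [Finset.card_union_of_disjoint hUS.1.1, hP, hS]
  have cQR : (Q ∪ R).card = v12 + v21 := by rw [Finset.card_union_of_disjoint hVR.2, hQ, hR]
  have cRS : (R ∪ S).card = v21 + v22 := by rw [Finset.card_union_of_disjoint hUS.2, hR, hS]
  obtain ⟨A, hAc, hAb, hA⟩ := exists_adjoined_pairCovers (k := k - 3) (by omega) cPR cQS hZ
    h1 h2 h5 (hYA.symm ▸ hTA)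
  obtain ⟨B, hBc, hBb, hB⟩ := exists_adjoined_pairCovers (k := k - 3) (by omega) cPS cQR hZ
    h3 h4 h5 (hYB.symm ▸ hTB)
  obtain ⟨C, hCc, hCb, hC⟩ := exists_adjoined_pairCovers (k := k - 2) (by omega) hV cRS hZ
    h6 h7 h8 (hYC.symm ▸ hTC)
  rw [hYA, hcA] at hAb
  rw [hYB, hcB] at hBb
  rw [hYC, hcC] at hCb
  obtain ⟨F, hF⟩ : ∃ F, F = G ∪ A ∪ B ∪ C := ⟨_, rfl⟩
  have hFG : ∀ E ∈ G, E ∈ F := fun E hE => by simp [hF, hE]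
  have hFA : ∀ E ∈ A, E ∈ F := fun E hE => by simp [hF, hE]
  have hFB : ∀ E ∈ B, E ∈ F := fun E hE => by simp [hF, hE]
  have hFC : ∀ E ∈ C, E ∈ F := fun E hE => by simp [hF, hE]
  have hX : (Y ∪ {x, v, v + 1, v + 2}).card = v + 3 := by
    have : Y ∪ {x, v, v + 1, v + 2} = Finset.range (v + 3) := by
      ext a
      simp only [hY, Finset.mem_union, Finset.mem_erase, Finset.mem_range, Finset.mem_insert,
        Finset.mem_singleton]
      omega
    rw [this, Finset.card_range]
  have hcover : IsCover (Y ∪ {x, v, v + 1, v + 2}) F k 4 6 := by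
    refine ⟨?_, fun M hM hM6 => ?_⟩
    · intro E hE
      simp only [hF, Finset.mem_union] at hE
      rcases hE with ((hE | hE) | hE) | hE
      · exact hG E hE
      · exact ⟨(hAb E hE).1.trans (by clear * -; grind), by rw [(hAb E hE).2]; omega⟩
      · exact ⟨(hBb E hE).1.trans (by clear * -; grind), by rw [(hBb E hE).2]; omega⟩
      · exact ⟨(hCb E hE).1.trans (by clear * -; grind), by rw [(hCb E hE).2]; omega⟩
    · rw [← hWZY] at hx₁ hx₂ hx₃ hx₄ hzero hone hM hYA hYB
      refine exists_block_of_spliced (by omega) (by omega) (by omega) (by omega) (by omega)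
        (by omega) hx₁ hx₂ hx₃ hx₄ ?_ ?_ ?_ ?_ ?_ ?_ ?_ hM hM6
      · intro N hN h
        exact (hzero N hN h).imp fun E hE => ⟨hFG E hE.1, hE.2⟩
      · intro y hy N hN h
        exact (hone y hy N hN h).imp fun E hE => ⟨hFG E hE.1, hE.2⟩
      · intro a b hab hs
        exact (hA a b hab hs).imp fun E hE => ⟨hFA E hE.1, hE.2⟩
      · intro a b hab hs
        exact (hB a b hab hs).imp fun E hE => ⟨hFB E hE.1, hE.2⟩
      · intro a b hab hs
        exact (hC a b hab hs).imp fun E hE => ⟨hFC E hE.1, hE.2⟩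
      · intro a ha
        obtain ⟨b, hab, hs⟩ := exists_samePart_ne (by omega) (by omega) (by omega)
          (hYA.symm ▸ ha)
        exact (hA a b hab hs).imp fun E hE => ⟨hFA E hE.1, hE.2.1, hE.2.2.1⟩
      · intro a ha
        obtain ⟨b, hab, hs⟩ := exists_samePart_ne (by omega) (by omega) (by omega)
          (hYB.symm ▸ ha)
        exact (hB a b hab hs).imp fun E hE => ⟨hFB E hE.1, hE.2.1, hE.2.2.1⟩
  have hle := coverNumber_le_of_isCover hX hcover
  have hu₁ := Finset.card_union_le (G ∪ A ∪ B) C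
  have hu₂ := Finset.card_union_le (G ∪ A) B
  have hu₃ := Finset.card_union_le G A
  rw [← hF] at hu₁
  omega
end

section
/- Let m ≥ 3 and let X be a set of v elements partitioned into m−1 quasi-equal parts X₀, X₁, …, X_{m−2} of sizes v₀, …, v_{m−2} ≥ 4. For each i, let (X_i, B_i) be a (v_i, 2, 1) covering design with w_i = ⌈v_i/2⌉ blocks B_i^1, …, B_i^{w_i}, and let h_i = w_{(i+1) mod (m−1)}. For each i, let (X_i, A_i^1), …, (X_i, A_i^{h_i}) be (v_i, 4, 2) covering designs such that (X_i, A_i^1 ∪ ⋯ ∪ A_i^{h_i}) is a (v_i, 4, 3) covering design. Define C_i = ⋃_{j=1}^{h_i} { A ∪ B^j_{(i+1) mod (m−1)} : A ∈ A_i^j }. Then (X, ⋃_{i=0}^{m−2} C_i) is a (v, 6, 3, m) cover. -/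
/-- A subset of `X` with at least `t` points meets some block of a `t`-covering design
on `X` in at least `t` points. -/
theorem IsCover.exists_le_card_inter {α : Type*} [DecidableEq α] {X : Finset α}
    {Bs : Finset (Finset α)} {k t : ℕ} (hC : IsCover X Bs k t t) {S : Finset α}
    (hS : S ⊆ X) (ht : t ≤ S.card) : ∃ B ∈ Bs, t ≤ (S ∩ B).card := by
  obtain ⟨T, hTS, hT⟩ := Finset.exists_subset_card_eq ht
  obtain ⟨B, hB, hle⟩ := hC.2 T (hTS.trans hS) hT
  exact ⟨B, hB, hle.trans (Finset.card_le_card (Finset.inter_subset_inter_right hTS))⟩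

theorem Fin.injective_succ_mod (n : ℕ) (hn : 0 < n) :
    Function.Injective fun i : Fin n => (⟨((i : ℕ) + 1) % n, Nat.mod_lt _ hn⟩ : Fin n) := by
  intro i j hij
  have hmod : (i : ℕ) + 1 ≡ (j : ℕ) + 1 [MOD n] := congrArg Fin.val hij
  exact Fin.ext ((Nat.ModEq.add_right_cancel' 1 hmod).eq_of_lt_of_lt i.2 j.2)

theorem Fin.succ_mod_ne (n : ℕ) (hn : 2 ≤ n) (i : Fin n) :
    (⟨((i : ℕ) + 1) % n, Nat.mod_lt _ (by omega)⟩ : Fin n) ≠ i := by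
  intro hi
  have hval : ((i : ℕ) + 1) % n = i := congrArg Fin.val hi
  have hlt := i.2
  rcases Nat.lt_or_ge ((i : ℕ) + 1) n with hs | hs
  · rw [Nat.mod_eq_of_lt hs] at hval
    omega
  · have he : (i : ℕ) + 1 = n := by omega
    rw [he, Nat.mod_self] at hval
    omega

/-- If a function bounded by `2` on a finite type has sum exceeding the cardinality, then along
any injective self-map some value `2` is followed by a nonzero value. -/
theorem exists_eq_two_of_card_lt_sum {ι : Type*} [Fintype ι] {σ : ι → ι}
    (hσ : Function.Injective σ) (a : ι → ℕ) (ha : ∀ i, a i ≤ 2)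
    (hsum : Fintype.card ι < ∑ i, a i) : ∃ i, a i = 2 ∧ 0 < a (σ i) := by
  by_contra! hcon
  let z : ι → ℕ := fun i => if a i = 0 then 1 else 0
  have hz : ∑ i, z (σ i) = ∑ i, z i :=
    Fintype.sum_bijective σ (Finite.injective_iff_bijective.1 hσ) _ _ fun _ => rfl
  have hle : ∑ i, (a i + z i) ≤ ∑ i, (1 + z (σ i)) := by
    refine Finset.sum_le_sum fun i _ => ?_
    have h2 := ha i
    have h0 := hcon i
    dsimp only [z]
    split_ifs <;> omega
  rw [Finset.sum_add_distrib, Finset.sum_add_distrib, hz] at hle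
  simp only [Finset.sum_const, Finset.card_univ, smul_eq_mul, mul_one] at hle
  omega

/-- Trapping-triples construction for `(v,6,3,m)` covers: partition `X` into `m-1`
quasi-equal parts; on part `i` take a `(vᵢ,2,1)` covering design with `wᵢ = ⌈vᵢ/2⌉`
blocks `Bb i 0, …, Bb i (wᵢ-1)` and `hᵢ = w_{(i+1) mod (m-1)}` many `(vᵢ,4,2)` covering
designs whose union is a `(vᵢ,4,3)` covering design.  Then the blocks
`A ∪ B^j_{(i+1) mod (m-1)}` with `A ∈ 𝓐ᵢʲ` form a `(v,6,3,m)` cover. -/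
theorem trapping_triples_63m {α : Type*} [DecidableEq α]
    (m v : ℕ) (hm : 3 ≤ m)
    (X : Finset α) (hX : X.card = v)
    (parts : Fin (m - 1) → Finset α)
    (hdisj : ∀ i j, i ≠ j → Disjoint (parts i) (parts j))
    (hunion : Finset.univ.biUnion parts = X)
    (hquasi : ∀ i j, (parts i).card ≤ (parts j).card + 1)
    (hsize : ∀ i, 4 ≤ (parts i).card)
    (w : Fin (m - 1) → ℕ) (hw : ∀ i, w i = ((parts i).card + 1) / 2)
    (Bb : Fin (m - 1) → ℕ → Finset α)
    (hBblock : ∀ i, ∀ j < w i, Bb i j ⊆ parts i ∧ (Bb i j).card = 2)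
    (hBcov : ∀ i, ∀ x ∈ parts i, ∃ j < w i, x ∈ Bb i j)
    (h : Fin (m - 1) → ℕ)
    (hh : ∀ i, h i = w ⟨((i : ℕ) + 1) % (m - 1), Nat.mod_lt _ (by omega)⟩)
    (Ad : Fin (m - 1) → ℕ → Finset (Finset α))
    (hA2 : ∀ i, ∀ j < h i, IsCover (parts i) (Ad i j) 4 2 2)
    (hA3 : ∀ i, IsCover (parts i) ((Finset.range (h i)).biUnion (Ad i)) 4 3 3) :
    IsCover X
      (Finset.univ.biUnion fun i : Fin (m - 1) =>
        (Finset.range (h i)).biUnion fun j =>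
          (Ad i j).image fun A =>
            A ∪ Bb ⟨((i : ℕ) + 1) % (m - 1), Nat.mod_lt _ (by omega)⟩ j)
      6 3 m := by
  have hsucc := Fin.succ_mod_ne (m - 1) (by omega)
  have hpart : ∀ i, parts i ⊆ X := fun i =>
    hunion ▸ Finset.subset_biUnion_of_mem parts (Finset.mem_univ i)
  constructor
  · intro B hB
    simp only [Finset.mem_biUnion, Finset.mem_univ, true_and, Finset.mem_range,
      Finset.mem_image] at hB
    obtain ⟨i, j, hj, A, hA, rfl⟩ := hB
    obtain ⟨hAs, hAc⟩ := (hA2 i j hj).1 A hA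
    obtain ⟨hBs, hBc⟩ := hBblock _ j (hh i ▸ hj)
    refine ⟨Finset.union_subset (hAs.trans (hpart _)) (hBs.trans (hpart _)), ?_⟩
    rw [Finset.card_union_of_disjoint
      ((hdisj _ _ (hsucc i).symm).mono hAs hBs), hAc, hBc]
  · intro M hM hMc
    suffices hex : ∃ i, ∃ j < h i, ∃ A ∈ Ad i j,
        3 ≤ (M ∩ (A ∪ Bb ⟨((i : ℕ) + 1) % (m - 1), Nat.mod_lt _ (by omega)⟩ j)).card by
      obtain ⟨i, j, hj, A, hA, hle⟩ := hex
      refine ⟨_, ?_, hle⟩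
      simp only [Finset.mem_biUnion, Finset.mem_univ, true_and, Finset.mem_range,
        Finset.mem_image]
      exact ⟨i, j, hj, A, hA, rfl⟩
    by_cases h3 : ∃ i, 3 ≤ (M ∩ parts i).card
    · obtain ⟨i, hi⟩ := h3
      obtain ⟨A, hA, hle⟩ := (hA3 i).exists_le_card_inter Finset.inter_subset_right hi
      simp only [Finset.mem_biUnion, Finset.mem_range] at hA
      obtain ⟨j, hj, hA⟩ := hA
      exact ⟨i, j, hj, A, hA, hle.trans (Finset.card_le_card
        (Finset.inter_subset_inter Finset.inter_subset_left Finset.subset_union_left))⟩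
    · push Not at h3
      have hsum : ∑ i, (M ∩ parts i).card = m := by
        rw [← Finset.card_biUnion fun i _ j _ hij =>
          (hdisj i j hij).mono Finset.inter_subset_right Finset.inter_subset_right,
          ← Finset.inter_biUnion, hunion, Finset.inter_eq_left.2 hM, hMc]
      obtain ⟨i, hi, hpos⟩ := exists_eq_two_of_card_lt_sum
        (Fin.injective_succ_mod (m - 1) (by omega)) (fun i => (M ∩ parts i).card)
        (fun i => Nat.le_of_lt_succ (h3 i)) (by rw [hsum, Fintype.card_fin]; omega)
      obtain ⟨x, hx⟩ := Finset.card_pos.1 hpos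
      obtain ⟨hxM, hxp⟩ := Finset.mem_inter.1 hx
      obtain ⟨j, hj, hxB⟩ := hBcov _ x hxp
      have hj' : j < h i := (hh i).symm ▸ hj
      obtain ⟨A, hA, hle⟩ :=
        (hA2 i j hj').exists_le_card_inter Finset.inter_subset_right hi.ge
      refine ⟨i, j, hj', A, hA, ?_⟩
      have hxA : x ∉ M ∩ parts i ∩ A := fun hxA =>
        Finset.disjoint_left.1 (hdisj _ _ (hsucc i)) hxp
          (Finset.mem_inter.1 (Finset.mem_inter.1 hxA).1).2
      calc 3 ≤ (insert x (M ∩ parts i ∩ A)).card := by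
            rw [Finset.card_insert_of_notMem hxA]; omega
        _ ≤ _ := Finset.card_le_card <| Finset.insert_subset
            (Finset.mem_inter.2 ⟨hxM, Finset.mem_union_right _ hxB⟩)
            (Finset.inter_subset_inter Finset.inter_subset_left Finset.subset_union_left)
end
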